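/- Let F be the fermionic Fock space of the bc-system, with operators b(n), c(n) and the Heisenberg modes j_m defined in the context (the modes of the charge field j^{bc}(z) = :c(z)b(z):). Then for all m, n ∈ ℤ, as operators on F: j_m ∘ j_n − j_n ∘ j_m = m·δ_{m,−n}·id, j_m ∘ b(n) − b(n) ∘ j_m = −b(m+n), and j_m ∘ c(n) − c(n) ∘ j_m = c(m+n). -/

import Mathlib

noncomputable section

open ExteriorAlgebra

/-- Index type for the basis of `V`: `Sum.inl n` corresponds to `v_n` (`n ≥ 0`),
and `Sum.inr n` corresponds to `w_{n+1}` (so the `w_k` for `k ≥ 1`). -/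
abbrev BCIndex : Type := ℕ ⊕ ℕ

/-- The vector space `V` with basis `{v_n : n ≥ 0} ∪ {w_n : n ≥ 1}`. -/
abbrev BCSpace : Type := BCIndex →₀ ℂ

/-- The fermionic Fock space: the exterior algebra of `V`. -/
abbrev FockF : Type := ExteriorAlgebra ℂ BCSpace

/-- The basis vector of `V` with index `i`. -/
def bv (i : BCIndex) : BCSpace := Finsupp.single i 1

/-- The linear functional sending the basis vector `i` to `1` and all others to `0`. -/
def bvDual (i : BCIndex) : Module.Dual ℂ BCSpace := Finsupp.lapply i

/-- The operator `b(n)`: for `n ≤ 0` left exterior multiplication by `v_{-n}`,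
for `n ≥ 1` contraction with the functional dual to `w_n`. -/
def bOp (n : ℤ) : Module.End ℂ FockF :=
  if n ≤ 0 then LinearMap.mulLeft ℂ (ι ℂ (bv (Sum.inl (-n).toNat)))
  else CliffordAlgebra.contractLeft (bvDual (Sum.inr (n - 1).toNat))

/-- The operator `c(n)`: for `n ≥ 0` contraction with the functional dual to `v_n`,
for `n ≤ -1` left exterior multiplication by `w_{-n}`. -/
def cOp (n : ℤ) : Module.End ℂ FockF :=
  if 0 ≤ n then CliffordAlgebra.contractLeft (bvDual (Sum.inl n.toNat))
  else LinearMap.mulLeft ℂ (ι ℂ (bv (Sum.inr (-n - 1).toNat)))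

/-- The normally ordered product `:b(k)c(j):`. -/
def nbc (k j : ℤ) : Module.End ℂ FockF :=
  if 1 ≤ k ∧ j ≤ -1 then -(cOp j ∘ₗ bOp k) else bOp k ∘ₗ cOp j

/-- The Virasoro modes `L_m` of `T(z) = :∂b(z)c(z):`,
`L_m x = Σ_k (−k)·:b(k)c(m−k):·x` (a finite sum on each `x`). -/
def Lmode (m : ℤ) (x : FockF) : FockF :=
  ∑ᶠ k : ℤ, (-k : ℂ) • nbc k (m - k) x

/-- The modes `W̃_m` of `W̃(z) = (1/2)(:∂²b(z)c(z): − :∂b(z)∂c(z):)`,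
`W̃_m x = (1/2)Σ_k k(2k−m)·:b(k)c(m−k):·x` (a finite sum on each `x`). -/
def Wmode (m : ℤ) (x : FockF) : FockF :=
  ∑ᶠ k : ℤ, ((1 / 2 : ℂ) * k * (2 * k - m)) • nbc k (m - k) x

/-- The charge of a list of basis indices: (number of `v`-type) − (number of `w`-type). -/
def chargeOf (L : List BCIndex) : ℤ :=
  (L.countP Sum.isLeft : ℤ) - (L.countP Sum.isRight : ℤ)

/-- `F^l`: the span of the wedge monomials of charge `l`. -/
def FF (l : ℤ) : Submodule ℂ FockF :=
  Submodule.span ℂ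
    {x | ∃ L : List BCIndex, chargeOf L = l ∧ x = (L.map fun i => ι ℂ (bv i)).prod}

/-- `F̄^l = {x ∈ F^l : c(0)x = 0}`. -/
def FFbar (l : ℤ) : Submodule ℂ FockF := FF l ⊓ LinearMap.ker (cOp 0)

/-- The normally ordered product `:c(k)b(j):`. -/
def ncb (k j : ℤ) : Module.End ℂ FockF :=
  if 0 ≤ k ∧ j ≤ 0 then -(bOp j ∘ₗ cOp k) else cOp k ∘ₗ bOp j

/-- The Heisenberg modes `j_m` of the charge field `j^{bc}(z) = :c(z)b(z):`,
`j_m x = Σ_k :c(k)b(m−k):·x` (a finite sum on each `x`). -/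
def jmode (m : ℤ) (x : FockF) : FockF := ∑ᶠ k : ℤ, ncb k (m - k) x

lemma contractLeft_contractLeft_add (d e : Module.Dual ℂ BCSpace) (x : FockF) :
    CliffordAlgebra.contractLeft d (CliffordAlgebra.contractLeft e x) +
      CliffordAlgebra.contractLeft e (CliffordAlgebra.contractLeft d x) = 0 := by
  rw [CliffordAlgebra.contractLeft_comm]
  simp

lemma contractLeft_ι_mul_add (d : Module.Dual ℂ BCSpace) (v : BCSpace) (x : FockF) :
    CliffordAlgebra.contractLeft d (ι ℂ v * x) +
      ι ℂ v * CliffordAlgebra.contractLeft d x = d v • x := by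
  have h := CliffordAlgebra.contractLeft_ι_mul (Q := (0 : QuadraticForm ℂ BCSpace)) d v x
  rw [ExteriorAlgebra.ι, h]
  simp

lemma ι_mul_ι_mul_add (u v : BCSpace) (x : FockF) :
    ι ℂ u * (ι ℂ v * x) + ι ℂ v * (ι ℂ u * x) = 0 := by
  rw [← mul_assoc, ← mul_assoc, ← add_mul, ι_add_mul_swap, zero_mul]

/-- `b(m)c(n) + c(n)b(m) = δ_{m,−n}·id`. -/
lemma bOp_cOp_add (m n : ℤ) (x : FockF) :
    bOp m (cOp n x) + cOp n (bOp m x) = if m = -n then x else 0 := by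
  unfold bOp cOp
  split_ifs with h₁ h₂ h₃ h₃ h₂ h₃ h₃ <;> try simp only [LinearMap.mulLeft_apply]
  · rw [add_comm, contractLeft_ι_mul_add]
    simp [bv, bvDual, h₃]
  · rw [add_comm, contractLeft_ι_mul_add]
    have : (-m).toNat ≠ n.toNat := by omega
    simp [bv, bvDual, this]
  · omega
  · exact ι_mul_ι_mul_add _ _ x
  · omega
  · exact contractLeft_contractLeft_add _ _ x
  · rw [contractLeft_ι_mul_add]
    simp [bv, bvDual, h₃]
  · rw [contractLeft_ι_mul_add]
    have : (Sum.inr (m - 1).toNat : BCIndex) ≠ Sum.inr (-n - 1).toNat := by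
      rw [Ne, Sum.inr.injEq]
      omega
    rw [bvDual, bv, Finsupp.lapply_apply, Finsupp.single_eq_of_ne this, zero_smul]

/-- `b(m)b(n) + b(n)b(m) = 0`. -/
lemma bOp_bOp_add (m n : ℤ) (x : FockF) : bOp m (bOp n x) + bOp n (bOp m x) = 0 := by
  unfold bOp
  split_ifs <;> try simp only [LinearMap.mulLeft_apply]
  · exact ι_mul_ι_mul_add _ _ x
  · rw [add_comm, contractLeft_ι_mul_add]
    simp [bv, bvDual]
  · rw [contractLeft_ι_mul_add]
    simp [bv, bvDual]
  · exact contractLeft_contractLeft_add _ _ x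

/-- `c(m)c(n) + c(n)c(m) = 0`. -/
lemma cOp_cOp_add (m n : ℤ) (x : FockF) : cOp m (cOp n x) + cOp n (cOp m x) = 0 := by
  unfold cOp
  split_ifs <;> try simp only [LinearMap.mulLeft_apply]
  · exact contractLeft_contractLeft_add _ _ x
  · rw [contractLeft_ι_mul_add]
    simp [bv, bvDual]
  · rw [add_comm, contractLeft_ι_mul_add]
    simp [bv, bvDual]
  · exact ι_mul_ι_mul_add _ _ x

lemma finite_setOf_contractLeft_ne_zero (x : FockF) :
    {i | CliffordAlgebra.contractLeft (bvDual i) x ≠ 0}.Finite := by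
  induction x using CliffordAlgebra.left_induction with
  | algebraMap r => simp [CliffordAlgebra.contractLeft_algebraMap]
  | add x y hx hy =>
    refine (hx.union hy).subset fun i hi => ?_
    by_contra h
    simp_all
  | ι_mul x v hx =>
    refine (v.support.finite_toSet.union hx).subset fun i hi => ?_
    by_contra h
    simp_all [CliffordAlgebra.contractLeft_ι_mul, bvDual]

lemma exists_forall_contractLeft_eq_zero (f : ℕ → BCIndex) (hf : f.Injective) (x : FockF) :
    ∃ N, ∀ n ≥ N, CliffordAlgebra.contractLeft (bvDual (f n)) x = 0 := by
  obtain ⟨N, hN⟩ := ((finite_setOf_contractLeft_ne_zero x).preimage hf.injOn).bddAbove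
  refine ⟨N + 1, fun n hn => ?_⟩
  by_contra h
  have := hN (a := n) h
  omega

lemma exists_forall_bOp_eq_zero (x : FockF) : ∃ N : ℤ, ∀ n ≥ N, bOp n x = 0 := by
  obtain ⟨N, hN⟩ := exists_forall_contractLeft_eq_zero _ Sum.inr_injective x
  refine ⟨N + 1, fun n hn => ?_⟩
  rw [bOp, if_neg (by omega), hN _ (by omega)]

lemma exists_forall_cOp_eq_zero (x : FockF) : ∃ N : ℤ, ∀ n ≥ N, cOp n x = 0 := by
  obtain ⟨N, hN⟩ := exists_forall_contractLeft_eq_zero _ Sum.inl_injective x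
  refine ⟨N, fun n hn => ?_⟩
  rw [cOp, if_pos (by omega), hN _ (by omega)]

lemma ncb_apply (k j : ℤ) (x : FockF) :
    ncb k j x = cOp k (bOp j x) - if 0 ≤ k ∧ j = -k then x else 0 := by
  by_cases h : 0 ≤ k ∧ j ≤ 0
  · rw [ncb, if_pos h, LinearMap.neg_apply, LinearMap.comp_apply,
      eq_sub_of_add_eq (bOp_cOp_add j k x)]
    simp only [h.1, true_and]
    abel
  · rw [ncb, if_neg h, LinearMap.comp_apply, if_neg (by omega), sub_zero]

lemma finite_support_ncb (m : ℤ) (x : FockF) :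
    (Function.support fun k : ℤ => ncb k (m - k) x).Finite := by
  obtain ⟨N, hN⟩ := exists_forall_bOp_eq_zero x
  obtain ⟨M, hM⟩ := exists_forall_cOp_eq_zero x
  refine (Set.finite_Icc (min (m - N) (-1)) (max M (max m 0))).subset fun k hk => ?_
  by_contra h
  simp only [Set.mem_Icc, not_and_or, not_le, lt_min_iff, max_lt_iff] at h
  refine hk ?_
  dsimp only
  obtain h | h := h
  · rw [ncb, if_neg (by omega)]
    simp [hN (m - k) (by omega)]
  · rw [ncb, if_pos (by omega)]
    simp [hM k (by omega)]

/-- `j_m` as a linear endomorphism. -/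
def jEnd (m : ℤ) : Module.End ℂ FockF where
  toFun := jmode m
  map_add' x y := by
    simp only [jmode, map_add]
    exact finsum_add_distrib (finite_support_ncb m x) (finite_support_ncb m y)
  map_smul' r x := by
    simp only [jmode, map_smul, RingHom.id_apply]
    exact (smul_finsum' r (finite_support_ncb m x)).symm

lemma jEnd_apply (m : ℤ) (x : FockF) : jEnd m x = jmode m x := rfl

lemma map_jmode (A : Module.End ℂ FockF) (m : ℤ) (x : FockF) :
    A (jmode m x) = ∑ᶠ k : ℤ, A (ncb k (m - k) x) :=
  A.toAddMonoidHom.map_finsum (finite_support_ncb m x)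

lemma finite_support_map_ncb (A : Module.End ℂ FockF) (m : ℤ) (x : FockF) :
    (Function.support fun k : ℤ => A (ncb k (m - k) x)).Finite :=
  (finite_support_ncb m x).subset (Function.support_comp_subset (map_zero A) _)

lemma jmode_map_sub_map_jmode (A : Module.End ℂ FockF) (m : ℤ) (x : FockF) :
    jmode m (A x) - A (jmode m x) =
      ∑ᶠ k : ℤ, (ncb k (m - k) (A x) - A (ncb k (m - k) x)) := by
  rw [map_jmode, finsum_sub_distrib (finite_support_ncb m _) (finite_support_map_ncb A m x)]
  rfl

lemma ncb_bOp_sub (k j n : ℤ) (x : FockF) :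
    ncb k j (bOp n x) - bOp n (ncb k j x) = if k = -n then -bOp j x else 0 := by
  have h₁ := eq_neg_of_add_eq_zero_left (bOp_bOp_add j n x)
  have h₂ := eq_sub_of_add_eq (bOp_cOp_add n k (bOp j x))
  simp only [ncb_apply, map_sub, h₁, h₂, map_neg, apply_ite (bOp n), map_zero]
  split_ifs <;> first | omega | abel

lemma ncb_cOp_sub (k j n : ℤ) (x : FockF) :
    ncb k j (cOp n x) - cOp n (ncb k j x) = if j = -n then cOp k x else 0 := by
  have h₁ := eq_sub_of_add_eq (bOp_cOp_add j n x)
  have h₂ := eq_neg_of_add_eq_zero_left (cOp_cOp_add n k (bOp j x))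
  simp only [ncb_apply, map_sub, h₁, h₂, apply_ite (cOp n), apply_ite (cOp k), map_zero]
  split_ifs <;> abel

/-- `[j_m, b(n)] = −b(m+n)`. -/
lemma jmode_bOp_sub (m n : ℤ) (x : FockF) :
    jmode m (bOp n x) - bOp n (jmode m x) = -bOp (m + n) x := by
  rw [jmode_map_sub_map_jmode]
  simp only [ncb_bOp_sub]
  rw [finsum_eq_single _ (-n) fun k hk => if_neg hk, if_pos rfl, sub_neg_eq_add]

/-- `[j_m, c(n)] = c(m+n)`. -/
lemma jmode_cOp_sub (m n : ℤ) (x : FockF) :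
    jmode m (cOp n x) - cOp n (jmode m x) = cOp (m + n) x := by
  rw [jmode_map_sub_map_jmode]
  simp only [ncb_cOp_sub]
  rw [finsum_eq_single _ (m + n) fun k hk => if_neg (by omega), if_pos (by ring)]

lemma jmode_ncb_sub (m k j : ℤ) (x : FockF) :
    jmode m (ncb k j x) - ncb k j (jmode m x) =
      cOp (m + k) (bOp j x) - cOp k (bOp (m + j) x) := by
  have h₁ := eq_add_of_sub_eq (jmode_cOp_sub m k (bOp j x))
  have h₂ := eq_add_of_sub_eq (jmode_bOp_sub m j x)
  simp only [ncb_apply, ← jEnd_apply, map_sub, apply_ite (jEnd m), map_zero] at *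
  rw [h₁, h₂, map_add, map_neg]
  abel

/-- The anomaly sum: `Σ_k ([k ≥ −m] − [k ≥ 0]) = m`. -/
lemma finsum_ite_sub_ite {E : Type*} [AddCommGroup E] [Module ℂ E] (m : ℤ) (x : E) :
    (Function.support fun k : ℤ =>
      (if 0 ≤ m + k then x else 0) - if 0 ≤ k then x else 0).Finite ∧
    ∑ᶠ k : ℤ, ((if 0 ≤ m + k then x else 0) - if 0 ≤ k then x else 0) = (m : ℂ) • x := by
  have hs : (Function.support fun k : ℤ =>
      (if 0 ≤ m + k then x else 0) - if 0 ≤ k then x else 0) ⊆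
      (Finset.Ico (-m) 0 ∪ Finset.Ico 0 (-m) : Finset ℤ) := by
    intro k hk
    by_contra h
    simp only [Finset.coe_union, Finset.coe_Ico, Set.mem_union, Set.mem_Ico] at h
    refine hk ?_
    dsimp only
    split_ifs <;> first | omega | simp
  refine ⟨(Finset.finite_toSet _).subset hs, ?_⟩
  rw [finsum_eq_sum_of_support_subset _ hs]
  obtain hm | hm := le_total 0 m
  · lift m to ℕ using hm
    rw [Finset.Ico_eq_empty (a := 0) (by omega), Finset.union_empty,
      Finset.sum_congr rfl (g := fun _ => x)]
    · simp [← Nat.cast_smul_eq_nsmul ℂ]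
    · intro k hk
      rw [Finset.mem_Ico] at hk
      rw [if_pos (by omega), if_neg (by omega), sub_zero]
  · obtain ⟨p, rfl⟩ : ∃ p : ℕ, m = -p := ⟨m.natAbs, by omega⟩
    rw [Finset.Ico_eq_empty (a := -(-(p : ℤ))) (by omega), Finset.empty_union,
      Finset.sum_congr rfl (g := fun _ => -x)]
    · simp [← Nat.cast_smul_eq_nsmul ℂ]
    · intro k hk
      rw [Finset.mem_Ico] at hk
      rw [if_neg (by omega), if_pos (by omega), zero_sub]

/-- `[j_m, j_n] = m·δ_{m,−n}·id`. -/
lemma jmode_jmode_sub (m n : ℤ) (x : FockF) :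
    jmode m (jmode n x) - jmode n (jmode m x) = (m : ℂ) • (if m = -n then x else 0) := by
  set g : ℤ → FockF := fun k => ncb k (m + n - k) x with hg_def
  set y : FockF := if m = -n then x else 0 with hy
  have hg : (Function.support g).Finite := finite_support_ncb (m + n) x
  have hg' : (Function.support fun k => g (m + k)).Finite :=
    hg.preimage (add_right_injective m).injOn
  have hsum : ∑ᶠ k, g (m + k) = ∑ᶠ k, g k := finsum_comp_equiv (Equiv.addLeft m)
  have hterm (k : ℤ) : jmode m (ncb k (n - k) x) - ncb k (n - k) (jmode m x) =
      (g (m + k) - g k) + ((if 0 ≤ m + k then y else 0) - if 0 ≤ k then y else 0) := by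
    have e₁ : m + n - (m + k) = n - k := by ring
    have e₂ : m + (n - k) = m + n - k := by ring
    rw [jmode_ncb_sub, hg_def, hy]
    simp only [ncb_apply, e₁, e₂]
    split_ifs <;> first | omega | abel
  obtain ⟨hfin, hanom⟩ := finsum_ite_sub_ite m y
  have hsub : (Function.support fun k => g (m + k) - g k).Finite :=
    (hg'.union hg).subset (Function.support_sub _ _)
  calc jmode m (jmode n x) - jmode n (jmode m x)
      = ∑ᶠ k, (jmode m (ncb k (n - k) x) - ncb k (n - k) (jmode m x)) := by
        simp only [← jEnd_apply m]
        rw [finsum_sub_distrib (finite_support_map_ncb (jEnd m) n x) (finite_support_ncb n _),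
          map_jmode, jmode]
    _ = (m : ℂ) • y := by
        simp only [hterm]
        rw [finsum_add_distrib hsub hfin, finsum_sub_distrib hg' hg, hsum, sub_self, zero_add,
          hanom]

/-- `[j_m, j_n] = m·δ_{m,−n}·id`, `[j_m, b(n)] = −b(m+n)`, `[j_m, c(n)] = c(m+n)`. -/
theorem heisenberg_commutators (m n : ℤ) (x : FockF) :
    jmode m (jmode n x) - jmode n (jmode m x) = (m : ℂ) • (if m = -n then x else 0) ∧
    jmode m (bOp n x) - bOp n (jmode m x) = -(bOp (m + n) x) ∧
    jmode m (cOp n x) - cOp n (jmode m x) = cOp (m + n) x := by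
  exact ⟨jmode_jmode_sub m n x, jmode_bOp_sub m n x, jmode_cOp_sub m n x⟩
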